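/- arXiv:2312.03807 — 2 statements merged into one kernel-verified Lean document; each statement's English description precedes it below -/
import Mathlib

section
/- Let p, q ≥ 1 and equip Z = ℝ^p × ℝ^q with the Euclidean product norm. Let Φ : ℝ^p → ℝ be differentiable with L_f-Lipschitz gradient. Let F : Z → ℝ^p be L_fx-Lipschitz and J : Z → L(ℝ^q, ℝ^p) be L_gxy-Lipschitz in operator norm with ‖J(z)‖² ≤ C_gxy for all z. Fix x ∈ ℝ^p, y, y*, v, v* ∈ ℝ^q with ‖v*‖² ≤ C_fy/μ² (μ > 0, C_fy ≥ 0), and assume ∇Φ(x) = F(x, y*) − J(x, y*) v*. Let h ∈ ℝ^p, e := h − (F(x,y) − J(x,y)v), α > 0, and x' := x − α h. Then Φ(x') ≤ Φ(x) − (α/2)‖∇Φ(x)‖² − (α/2)(1 − α L_f)‖h‖² + α‖e‖² + 4α(L_fx² + C_fy L_gxy²/μ²)‖y − y*‖² + 2α C_gxy ‖v − v*‖². -/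
abbrev E (n : ℕ) := EuclideanSpace ℝ (Fin n)

abbrev Z (p q : ℕ) := WithLp 2 (E p × E q)

noncomputable def zmk {p q : ℕ} (x : E p) (y : E q) : Z p q :=
  (WithLp.equiv 2 (E p × E q)).symm (x, y)

theorem le_add_inner_gradient_of_lipschitz {V : Type*} [NormedAddCommGroup V]
    [InnerProductSpace ℝ V] [CompleteSpace V] {f : V → ℝ} {L : ℝ} (hf : Differentiable ℝ f)
    (hL : ∀ a b : V, ‖gradient f a - gradient f b‖ ≤ L * ‖a - b‖) (x d : V) :
    f (x + d) ≤ f x + inner ℝ (gradient f x) d + L / 2 * ‖d‖ ^ 2 := by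
  have hderiv (t : ℝ) :
      HasDerivAt (fun s : ℝ => f (x + s • d)) (inner ℝ (gradient f (x + t • d)) d) t := by
    have hline : HasDerivAt (fun s : ℝ => x + s • d) d t := by
      simpa using ((hasDerivAt_id t).smul_const d).const_add x
    exact (hf (x + t • d)).hasGradientAt.hasFDerivAt.comp_hasDerivAt t hline
  have hbound (t : ℝ) : HasDerivAt
      (fun s : ℝ => f x + s * inner ℝ (gradient f x) d + L / 2 * ‖d‖ ^ 2 * s ^ 2)
      (inner ℝ (gradient f x) d + L * t * ‖d‖ ^ 2) t := by
    refine ((((hasDerivAt_id t).mul_const (inner ℝ (gradient f x) d)).const_add (f x)).add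
      ((hasDerivAt_pow 2 t).const_mul (L / 2 * ‖d‖ ^ 2))).congr_deriv ?_
    norm_num
    ring
  have key := image_le_of_deriv_right_le_deriv_boundary (a := 0) (b := 1)
    (fun t _ => (hderiv t).continuousAt.continuousWithinAt)
    (fun t _ => (hderiv t).hasDerivWithinAt) (by simp)
    (fun t _ => (hbound t).continuousAt.continuousWithinAt)
    (fun t _ => (hbound t).hasDerivWithinAt) (fun t ht => by
      have hcs := real_inner_le_norm (gradient f (x + t • d) - gradient f x) d
      have hlip := hL (x + t • d) x
      rw [add_sub_cancel_left, norm_smul, Real.norm_of_nonneg ht.1] at hlip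
      rw [inner_sub_left] at hcs
      nlinarith [mul_le_mul_of_nonneg_right hlip (norm_nonneg d)])
    (Set.right_mem_Icc.2 zero_le_one)
  simpa using key

theorem norm_add_sq_le_two_mul {V : Type*} [SeminormedAddCommGroup V] (a b : V) :
    ‖a + b‖ ^ 2 ≤ 2 * ‖a‖ ^ 2 + 2 * ‖b‖ ^ 2 := by
  nlinarith [norm_add_le a b, norm_nonneg (a + b), sq_nonneg (‖a‖ - ‖b‖)]

theorem norm_zmk_sub_zmk_left {p q : ℕ} (x : E p) (y y' : E q) :
    ‖zmk x y - zmk x y'‖ = ‖y - y'‖ := by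
  have h : zmk x y - zmk x y' = WithLp.toLp 2 ((0 : E p), y - y') := by
    simp [zmk, ← WithLp.toLp_sub]
  rw [h, WithLp.prod_norm_eq_of_L2]
  simp

theorem norm_surrogate_sub_sq_le {V W : Type*} [NormedAddCommGroup V] [NormedSpace ℝ V]
    [NormedAddCommGroup W] [NormedSpace ℝ W] {a a' : V} {A A' : W →L[ℝ] V} {v v' : W}
    {K M C B r : ℝ} (ha : ‖a - a'‖ ≤ K * r) (hA : ‖A - A'‖ ≤ M * r) (hC : ‖A‖ ^ 2 ≤ C)
    (hB : ‖v'‖ ^ 2 ≤ B) :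
    ‖(a - A v) - (a' - A' v')‖ ^ 2
      ≤ 4 * (K ^ 2 + B * M ^ 2) * r ^ 2 + 2 * C * ‖v - v'‖ ^ 2 := by
  have hsplit : (a - A v) - (a' - A' v')
      = ((a - a') + -((A - A') v')) + -(A (v - v')) := by
    simp only [sub_apply, map_sub]
    abel
  have h₁ := norm_add_sq_le_two_mul ((a - a') + -((A - A') v')) (-(A (v - v')))
  have h₂ := norm_add_sq_le_two_mul (a - a') (-((A - A') v'))
  rw [norm_neg] at h₁ h₂
  have h₃ : ‖a - a'‖ ^ 2 ≤ (K * r) ^ 2 := by gcongr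
  have h₄ : ‖(A - A') v'‖ ^ 2 ≤ (M * r) ^ 2 * B := calc
    ‖(A - A') v'‖ ^ 2 ≤ (‖A - A'‖ * ‖v'‖) ^ 2 := by gcongr; exact (A - A').le_opNorm v'
    _ = ‖A - A'‖ ^ 2 * ‖v'‖ ^ 2 := mul_pow _ _ _
    _ ≤ (M * r) ^ 2 * B := by gcongr
  have h₅ : ‖A (v - v')‖ ^ 2 ≤ C * ‖v - v'‖ ^ 2 := calc
    ‖A (v - v')‖ ^ 2 ≤ (‖A‖ * ‖v - v'‖) ^ 2 := by gcongr; exact A.le_opNorm _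
    _ = ‖A‖ ^ 2 * ‖v - v'‖ ^ 2 := mul_pow _ _ _
    _ ≤ C * ‖v - v'‖ ^ 2 := by gcongr
  rw [hsplit]
  linarith

/-- Lemma C.1 (descent in the function value), deterministic form: for the
upper-level update `x' = x - α h` with hypergradient surrogate
`F(x,y) - J(x,y) v`, true hypergradient `∇Φ(x) = F(x,y*) - J(x,y*) v*` and
`‖v*‖² ≤ C_fy/μ²`,
`Φ(x') ≤ Φ(x) - (α/2)‖∇Φ(x)‖² - (α/2)(1 - α L_f)‖h‖² + α‖e‖²
  + 4α(L_fx² + C_fy L_gxy²/μ²)‖y - y*‖² + 2α C_gxy ‖v - v*‖²`. -/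
theorem descent_function_value {p q : ℕ} (hp : 1 ≤ p) (hq : 1 ≤ q)
    (Φ : E p → ℝ) (F : Z p q → E p) (J : Z p q → (E q →L[ℝ] E p))
    (L_f L_fx L_gxy C_gxy C_fy μ : ℝ) (hμ : 0 < μ) (hCfy : 0 ≤ C_fy)
    (hΦdiff : Differentiable ℝ Φ)
    (hΦlip : ∀ a b : E p, ‖gradient Φ a - gradient Φ b‖ ≤ L_f * ‖a - b‖)
    (hF : ∀ z₁ z₂ : Z p q, ‖F z₁ - F z₂‖ ≤ L_fx * ‖z₁ - z₂‖)
    (hJ : ∀ z₁ z₂ : Z p q, ‖J z₁ - J z₂‖ ≤ L_gxy * ‖z₁ - z₂‖)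
    (hJbd : ∀ z : Z p q, ‖J z‖ ^ 2 ≤ C_gxy)
    (x : E p) (y ystar v vstar : E q)
    (hvstar : ‖vstar‖ ^ 2 ≤ C_fy / μ ^ 2)
    (hgrad : gradient Φ x = F (zmk x ystar) - J (zmk x ystar) vstar)
    (h : E p) (α : ℝ) (hα : 0 < α) :
    Φ (x - α • h)
      ≤ Φ x - α / 2 * ‖gradient Φ x‖ ^ 2
        - α / 2 * (1 - α * L_f) * ‖h‖ ^ 2
        + α * ‖h - (F (zmk x y) - J (zmk x y) v)‖ ^ 2
        + 4 * α * (L_fx ^ 2 + C_fy * L_gxy ^ 2 / μ ^ 2) * ‖y - ystar‖ ^ 2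
        + 2 * α * C_gxy * ‖v - vstar‖ ^ 2 := by
  have hdesc := le_add_inner_gradient_of_lipschitz hΦdiff hΦlip x (-(α • h))
  rw [← sub_eq_add_neg, inner_neg_right, real_inner_smul_right, norm_neg, norm_smul,
    Real.norm_of_nonneg hα.le] at hdesc
  have hpolar := norm_sub_sq_real h (gradient Φ x)
  rw [real_inner_comm] at hpolar
  have herr := norm_add_sq_le_two_mul (h - (F (zmk x y) - J (zmk x y) v))
    ((F (zmk x y) - J (zmk x y) v) - gradient Φ x)
  rw [sub_add_sub_cancel] at herr
  have hFy := hF (zmk x y) (zmk x ystar)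
  have hJy := hJ (zmk x y) (zmk x ystar)
  rw [norm_zmk_sub_zmk_left] at hFy hJy
  have hsur := norm_surrogate_sub_sq_le (v := v) hFy hJy (hJbd (zmk x y)) hvstar
  rw [← hgrad, div_mul_eq_mul_div] at hsur
  have hα_err := mul_le_mul_of_nonneg_left herr hα.le
  have hα_sur := mul_le_mul_of_nonneg_left hsur hα.le
  rw [hpolar] at hα_err
  linarith
end

section
/- Let G : ℝ^p × ℝ^q → ℝ^q and μ, L_g > 0 satisfy, for every x ∈ ℝ^p and all y₁, y₂ ∈ ℝ^q: ⟨G(x,y₁) − G(x,y₂), y₁ − y₂⟩ ≥ (μ L_g/(μ + L_g)) ‖y₁ − y₂‖² + (1/(μ + L_g)) ‖G(x,y₁) − G(x,y₂)‖². Let y* : ℝ^p → ℝ^q be L_y-Lipschitz with G(x, y*(x)) = 0 for all x. Fix x, h_f ∈ ℝ^p, y, h_g ∈ ℝ^q, stepsizes α, β > 0 and any γ, δ > 0; set x' = x − α h_f, y' = y − β h_g, and e_g := h_g − G(x,y). Then ‖y' − y*(x')‖² ≤ (1+γ)(1+δ)(1 − 2β μ L_g/(μ + L_g)) ‖y − y*(x)‖²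 − (1+γ)(1+δ)(2β/(μ + L_g) − β²) ‖G(x,y)‖² + (1+γ)(1 + 1/δ) β² ‖e_g‖² + (1 + 1/γ) L_y² α² ‖h_f‖². -/
open scoped RealInnerProductSpace

/-- Young's inequality for the squared norm of a sum. -/
theorem norm_add_sq_le_young {F : Type*} [SeminormedAddCommGroup F] (a b : F) {c : ℝ}
    (hc : 0 < c) : ‖a + b‖ ^ 2 ≤ (1 + c) * ‖a‖ ^ 2 + (1 + 1 / c) * ‖b‖ ^ 2 := by
  have h1 : ‖a + b‖ ^ 2 ≤ (‖a‖ + ‖b‖) ^ 2 := by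
    gcongr
    exact norm_add_le a b
  have h2 : (1 + c) * ‖a‖ ^ 2 + (1 + 1 / c) * ‖b‖ ^ 2 - (‖a‖ + ‖b‖) ^ 2
      = (c * ‖a‖ - ‖b‖) ^ 2 / c := by
    field_simp
    ring
  have h3 : 0 ≤ (c * ‖a‖ - ‖b‖) ^ 2 / c := by positivity
  linarith

/-- One exact gradient step contracts the distance to a zero of a co-coercive operator. -/
theorem norm_sub_smul_sq_le_of_cocoercive {F : Type*} [SeminormedAddCommGroup F]
    [InnerProductSpace ℝ F] (u g : F) {a b β : ℝ} (hβ : 0 ≤ β)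
    (h : a * ‖u‖ ^ 2 + b * ‖g‖ ^ 2 ≤ ⟪g, u⟫) :
    ‖u - β • g‖ ^ 2 ≤ (1 - 2 * β * a) * ‖u‖ ^ 2 - (2 * β * b - β ^ 2) * ‖g‖ ^ 2 := by
  rw [norm_sub_sq_real, real_inner_smul_right, real_inner_comm, norm_smul, mul_pow,
    Real.norm_eq_abs, sq_abs]
  linarith [mul_le_mul_of_nonneg_left h hβ]

/-- Descent lemma for the lower-level iterates (used in both FMBO and FdeHBO):
under co-coercivity of `G = ∇_y g` and `L_y`-Lipschitzness of the minimizer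
`y*`, the simultaneous updates `x' = x - α h_f`, `y' = y - β h_g` satisfy the
stated one-step contraction. -/
theorem descent_lower_level_iterates {p q : ℕ} (hp : 1 ≤ p) (hq : 1 ≤ q)
    (G : E p → E q → E q) (μ L_g L_y : ℝ) (hμ : 0 < μ) (hLg : 0 < L_g)
    (hcoco : ∀ (x : E p) (y₁ y₂ : E q),
      μ * L_g / (μ + L_g) * ‖y₁ - y₂‖ ^ 2
          + (μ + L_g)⁻¹ * ‖G x y₁ - G x y₂‖ ^ 2
        ≤ ⟪G x y₁ - G x y₂, y₁ - y₂⟫)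
    (ystar : E p → E q)
    (hylip : ∀ x₁ x₂ : E p, ‖ystar x₁ - ystar x₂‖ ≤ L_y * ‖x₁ - x₂‖)
    (hyzero : ∀ x, G x (ystar x) = 0)
    (x h_f : E p) (y h_g : E q) (α β γ δ : ℝ)
    (hα : 0 < α) (hβ : 0 < β) (hγ : 0 < γ) (hδ : 0 < δ) :
    ‖(y - β • h_g) - ystar (x - α • h_f)‖ ^ 2
      ≤ (1 + γ) * (1 + δ) * (1 - 2 * β * μ * L_g / (μ + L_g)) * ‖y - ystar x‖ ^ 2
        - (1 + γ) * (1 + δ) * (2 * β / (μ + L_g) - β ^ 2) * ‖G x y‖ ^ 2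
        + (1 + γ) * (1 + 1 / δ) * β ^ 2 * ‖h_g - G x y‖ ^ 2
        + (1 + 1 / γ) * L_y ^ 2 * α ^ 2 * ‖h_f‖ ^ 2 := by
  have hstep : ‖(y - ystar x) - β • G x y‖ ^ 2
      ≤ (1 - 2 * β * (μ * L_g / (μ + L_g))) * ‖y - ystar x‖ ^ 2
        - (2 * β * (μ + L_g)⁻¹ - β ^ 2) * ‖G x y‖ ^ 2 := by
    have h := hcoco x y (ystar x)
    rw [hyzero, sub_zero] at h
    exact norm_sub_smul_sq_le_of_cocoercive _ _ hβ.le h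
  have hinner : ‖(y - β • h_g) - ystar x‖ ^ 2
      ≤ (1 + δ) * ‖(y - ystar x) - β • G x y‖ ^ 2
        + (1 + 1 / δ) * (β ^ 2 * ‖h_g - G x y‖ ^ 2) := by
    have h := norm_add_sq_le_young ((y - ystar x) - β • G x y) (-(β • (h_g - G x y))) hδ
    rw [norm_neg, norm_smul, mul_pow, Real.norm_eq_abs, sq_abs] at h
    have heq : (y - ystar x) - β • G x y + -(β • (h_g - G x y)) = (y - β • h_g) - ystar x := by
      module
    rwa [heq] at h
  have hdrift : ‖ystar x - ystar (x - α • h_f)‖ ^ 2 ≤ L_y ^ 2 * α ^ 2 * ‖h_f‖ ^ 2 := by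
    have h := hylip x (x - α • h_f)
    rw [sub_sub_cancel, norm_smul, Real.norm_of_nonneg hα.le] at h
    calc ‖ystar x - ystar (x - α • h_f)‖ ^ 2 ≤ (L_y * (α * ‖h_f‖)) ^ 2 := by gcongr
      _ = L_y ^ 2 * α ^ 2 * ‖h_f‖ ^ 2 := by ring
  have houter := norm_add_sq_le_young ((y - β • h_g) - ystar x)
    (ystar x - ystar (x - α • h_f)) hγ
  rw [sub_add_sub_cancel] at houter
  calc ‖(y - β • h_g) - ystar (x - α • h_f)‖ ^ 2
      ≤ (1 + γ) * ‖(y - β • h_g) - ystar x‖ ^ 2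
        + (1 + 1 / γ) * ‖ystar x - ystar (x - α • h_f)‖ ^ 2 := houter
    _ ≤ (1 + γ) * ((1 + δ) * ((1 - 2 * β * (μ * L_g / (μ + L_g))) * ‖y - ystar x‖ ^ 2
          - (2 * β * (μ + L_g)⁻¹ - β ^ 2) * ‖G x y‖ ^ 2)
          + (1 + 1 / δ) * (β ^ 2 * ‖h_g - G x y‖ ^ 2))
        + (1 + 1 / γ) * (L_y ^ 2 * α ^ 2 * ‖h_f‖ ^ 2) := by
      gcongr
      exact hinner.trans (by gcongr)
    _ = _ := by ring
end
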